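/- Let U be an orbifold atlas of dimension n on X. Then the relation ∼ on R̂ (with triples whose targets have different index pairs (i,j) declared not related) is an equivalence relation. -/

import Mathlib

open Set

noncomputable section

/-- `ℂⁿ`. -/
abbrev CC (n : ℕ) : Type := EuclideanSpace ℂ (Fin n)

/-- A (reduced complex) uniformizing system of dimension `n` for the open set
`U := p '' Ut` of `X`: `Ut ⊆ ℂⁿ` is a nonempty connected open set, `G` is a finite
group of holomorphic automorphisms of `Ut` (encoded as total maps that agree with the
identity outside `Ut`, so that `G` is honestly a set of maps closed under composition
and inversion), and `p` (the map `π`) is continuous, surjective and `G`-invariant on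
`Ut`, inducing a homeomorphism `Ut/G ≃ U` (encoded by: the fibres of `p` on `Ut` are
exactly the `G`-orbits and `p` is an open map on `Ut`). -/
structure UniformizingSystem (n : ℕ) (X : Type*) [TopologicalSpace X] where
  Ut : Set (CC n)
  isOpen_Ut : IsOpen Ut
  isConnected_Ut : IsConnected Ut
  G : Set (CC n → CC n)
  finite_G : G.Finite
  id_mem_G : (id : CC n → CC n) ∈ G
  comp_mem_G : ∀ g ∈ G, ∀ h ∈ G, (g ∘ h) ∈ G
  inv_mem_G : ∀ g ∈ G, ∃ g' ∈ G, (∀ x, g' (g x) = x) ∧ (∀ x, g (g' x) = x)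
  mapsTo_G : ∀ g ∈ G, Set.MapsTo g Ut Ut
  eqOn_id_G : ∀ g ∈ G, Set.EqOn g id Utᶜ
  analytic_G : ∀ g ∈ G, AnalyticOnNhd ℂ g Ut
  p : CC n → X
  continuousOn_p : ContinuousOn p Ut
  isOpen_image_p : IsOpen (p '' Ut)
  invariant_p : ∀ g ∈ G, ∀ x ∈ Ut, p (g x) = p x
  exists_g_of_p_eq : ∀ x ∈ Ut, ∀ y ∈ Ut, p x = p y → ∃ g ∈ G, g x = y
  isOpenMap_p : ∀ V : Set (CC n), V ⊆ Ut → IsOpen V → IsOpen (p '' V)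

/-- The underlying open subset of `X` uniformized by the system. -/
def UniformizingSystem.U {n : ℕ} {X : Type*} [TopologicalSpace X]
    (𝒰 : UniformizingSystem n X) : Set X := 𝒰.p '' 𝒰.Ut

/-- An embedding `l : (Ũ,G,π) → (Ṽ,H,φ)` of uniformizing systems: a holomorphic
embedding (injective, biholomorphism onto its open image) with `φ ∘ l = π` on `Ũ`. -/
structure IsUSEmbedding {n : ℕ} {X : Type*} [TopologicalSpace X]
    (𝒰 𝒱 : UniformizingSystem n X) (l : CC n → CC n) : Prop where
  mapsTo : Set.MapsTo l 𝒰.Ut 𝒱.Ut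
  injOn : Set.InjOn l 𝒰.Ut
  analyticOn : AnalyticOnNhd ℂ l 𝒰.Ut
  isOpen_image : IsOpen (l '' 𝒰.Ut)
  exists_analytic_inv : ∃ m : CC n → CC n,
    AnalyticOnNhd ℂ m (l '' 𝒰.Ut) ∧ ∀ x ∈ 𝒰.Ut, m (l x) = x
  comp_p : ∀ x ∈ 𝒰.Ut, 𝒱.p (l x) = 𝒰.p x

/-- A (reduced complex) orbifold atlas of dimension `n` on `X`: a family of
uniformizing systems whose underlying open sets cover `X`, such that any two charts
are compatible at every point of the intersection of their underlying open sets. -/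
structure OrbifoldAtlas (n : ℕ) (X : Type*) [TopologicalSpace X] where
  I : Type
  chart : I → UniformizingSystem n X
  covers : ∀ x : X, ∃ i : I, x ∈ (chart i).U
  compat : ∀ i j : I, ∀ x ∈ (chart i).U ∩ (chart j).U,
    ∃ k : I, x ∈ (chart k).U ∧ (chart k).U ⊆ (chart i).U ∩ (chart j).U ∧
      (∃ l, IsUSEmbedding (chart k) (chart i) l) ∧
      (∃ l, IsUSEmbedding (chart k) (chart j) l)

/-- An element of the set `R̂` associated to an orbifold atlas `𝒰`: a triple
`(λ_ki, x̃_k, λ_kj)` consisting of a chart `(Ũ_k, G_k, π_k)` of `𝒰`, a point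
`x̃_k ∈ Ũ_k`, and two embeddings of this chart into charts of `𝒰`. -/
structure RHat {n : ℕ} {X : Type*} [TopologicalSpace X] (𝒰 : OrbifoldAtlas n X) where
  k : 𝒰.I
  i : 𝒰.I
  j : 𝒰.I
  x : CC n
  hx : x ∈ (𝒰.chart k).Ut
  li : CC n → CC n
  lj : CC n → CC n
  hli : IsUSEmbedding (𝒰.chart k) (𝒰.chart i) li
  hlj : IsUSEmbedding (𝒰.chart k) (𝒰.chart j) lj

section

open Filter Topology

variable {n : ℕ} {X : Type*} [TopologicalSpace X]

namespace UniformizingSystem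

theorem image_p_mem_nhds (M : UniformizingSystem n X) {z : CC n} (hz : z ∈ M.Ut)
    {O : Set (CC n)} (hO : O ∈ 𝓝 z) : M.p '' (O ∩ M.Ut) ∈ 𝓝 (M.p z) := by
  have h : interior O ∩ M.Ut ∈ 𝓝 z :=
    inter_mem (interior_mem_nhds.2 hO) (M.isOpen_Ut.mem_nhds hz)
  refine mem_of_superset ((M.isOpenMap_p _ inter_subset_right
    (isOpen_interior.inter M.isOpen_Ut)).mem_nhds ⟨z, mem_of_mem_nhds h, rfl⟩) ?_
  exact image_mono (inter_subset_inter_left _ interior_subset)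

end UniformizingSystem

namespace IsUSEmbedding

variable {R M K : UniformizingSystem n X} {l m : CC n → CC n}

protected theorem id (M : UniformizingSystem n X) : IsUSEmbedding M M id where
  mapsTo := mapsTo_id _
  injOn := injOn_id _
  analyticOn := fun _ _ => analyticAt_id
  isOpen_image := by simpa using M.isOpen_Ut
  exists_analytic_inv := ⟨id, fun _ _ => analyticAt_id, fun _ _ => rfl⟩
  comp_p := fun _ _ => rfl

theorem of_mem_G {g : CC n → CC n} (hg : g ∈ M.G) : IsUSEmbedding M M g := by
  obtain ⟨g', hg', h1, h2⟩ := M.inv_mem_G g hg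
  have himage : g '' M.Ut = M.Ut :=
    (M.mapsTo_G g hg).image_subset.antisymm
      fun x hx => ⟨g' x, M.mapsTo_G g' hg' hx, h2 x⟩
  exact
    { mapsTo := M.mapsTo_G g hg
      injOn := (Function.LeftInverse.injective h1).injOn
      analyticOn := M.analytic_G g hg
      isOpen_image := by rw [himage]; exact M.isOpen_Ut
      exists_analytic_inv := ⟨g', by rw [himage]; exact M.analytic_G g' hg', fun x _ => h1 x⟩
      comp_p := M.invariant_p g hg }

theorem comp (hm : IsUSEmbedding M K m) (hl : IsUSEmbedding R M l) :
    IsUSEmbedding R K (m ∘ l) := by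
  obtain ⟨m', hm'a, hm'⟩ := hm.exists_analytic_inv
  obtain ⟨l', hl'a, hl'⟩ := hl.exists_analytic_inv
  have himage : (m ∘ l) '' R.Ut = m '' M.Ut ∩ m' ⁻¹' (l '' R.Ut) := by
    ext y
    constructor
    · rintro ⟨x, hx, rfl⟩
      exact ⟨⟨l x, hl.mapsTo hx, rfl⟩, x, hx, (hm' _ (hl.mapsTo hx)).symm⟩
    · rintro ⟨⟨w, hw, rfl⟩, x, hx, h⟩
      exact ⟨x, hx, by rw [Function.comp_apply, h, hm' w hw]⟩
  refine
    { mapsTo := hm.mapsTo.comp hl.mapsTo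
      injOn := hm.injOn.comp hl.injOn hl.mapsTo
      analyticOn := hm.analyticOn.comp hl.analyticOn hl.mapsTo
      isOpen_image := himage ▸
        hm'a.continuousOn.isOpen_inter_preimage hm.isOpen_image hl.isOpen_image
      exists_analytic_inv := ⟨l' ∘ m', ?_, fun x hx => ?_⟩
      comp_p := fun x hx => (hm.comp_p _ (hl.mapsTo hx)).trans (hl.comp_p x hx) }
  · rw [himage]
    exact hl'a.comp (hm'a.mono inter_subset_left) fun y hy => hy.2
  · simp only [Function.comp_apply]
    rw [hm' _ (hl.mapsTo hx), hl' x hx]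

/-- If `R` uniformizes a smaller open set than `M`, the image of an embedding `R → K` that meets
the image of an embedding `M → K` is contained in it. -/
theorem image_subset_of_mem (hm : IsUSEmbedding M K m) (hl : IsUSEmbedding R K l)
    (hU : R.U ⊆ M.U) {x : CC n} (hx : x ∈ R.Ut) (hlx : l x ∈ m '' M.Ut) :
    MapsTo l R.Ut (m '' M.Ut) := by
  suffices h : R.Ut ⊆ R.Ut ∩ l ⁻¹' (m '' M.Ut) from fun y hy => (h hy).2
  refine R.isConnected_Ut.isPreconnected.subset_of_closure_inter_subset
    (hl.analyticOn.continuousOn.isOpen_inter_preimage R.isOpen_Ut hm.isOpen_image)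
    ⟨x, hx, hx, hlx⟩ ?_
  rintro y ⟨hyc, hy⟩
  refine ⟨hy, ?_⟩
  by_contra hly
  obtain ⟨z, hz, hzy⟩ := hU ⟨y, hy, rfl⟩
  have hne : ∀ᶠ q in 𝓝 (l y, z), ∀ h ∈ M.G, q.1 ≠ m (h q.2) := by
    rw [eventually_all_finite M.finite_G]
    intro h hh
    have hmh : ContinuousAt (fun o => m (h o)) z :=
      ((hm.analyticOn _ (M.mapsTo_G h hh hz)).comp (M.analytic_G h hh z hz)).continuousAt
    exact (continuousAt_fst.ne_iff_eventually_ne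
      (ContinuousAt.comp (x := (l y, z)) (f := Prod.snd) hmh continuousAt_snd)).1
        fun e => hly ⟨h z, M.mapsTo_G h hh hz, e.symm⟩
  obtain ⟨N, hN, O, hO, hNO⟩ := mem_nhds_prod_iff.1 hne
  have hN' : l ⁻¹' N ∈ 𝓝 y := (hl.analyticOn y hy).continuousAt hN
  have hO' : R.p ⁻¹' (M.p '' (O ∩ M.Ut)) ∈ 𝓝 y :=
    (R.continuousOn_p.continuousAt (R.isOpen_Ut.mem_nhds hy))
      (hzy ▸ M.image_p_mem_nhds hz hO)
  obtain ⟨y', ⟨hy'N, o, ⟨hoO, ho⟩, hoy'⟩, hy', w, hw, hwy'⟩ :=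
    mem_closure_iff_nhds.1 hyc _ (inter_mem hN' hO')
  have hp : M.p o = M.p w := by
    rw [hoy', ← hl.comp_p y' hy', ← hwy', hm.comp_p w hw]
  obtain ⟨h, hh, rfl⟩ := M.exists_g_of_p_eq o ho w hw hp
  exact hNO (mk_mem_prod hy'N hoO) h hh hwy'.symm

/-- An embedding `R → K` whose image is contained in the image of an embedding `M → K` factors
through it. -/
theorem exists_factorization (hm : IsUSEmbedding M K m) (hl : IsUSEmbedding R K l)
    (hlm : MapsTo l R.Ut (m '' M.Ut)) :
    ∃ f, IsUSEmbedding R M f ∧ ∀ y ∈ R.Ut, m (f y) = l y := by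
  obtain ⟨m', hm'a, hm'⟩ := hm.exists_analytic_inv
  obtain ⟨l', hl'a, hl'⟩ := hl.exists_analytic_inv
  have hmaps : MapsTo (m' ∘ l) R.Ut M.Ut := fun y hy => by
    obtain ⟨w, hw, h⟩ := hlm hy
    rwa [Function.comp_apply, ← h, hm' w hw]
  have hfac : ∀ y ∈ R.Ut, m ((m' ∘ l) y) = l y := fun y hy => by
    obtain ⟨w, hw, h⟩ := hlm hy
    rw [Function.comp_apply, ← h, hm' w hw]
  have himage : (m' ∘ l) '' R.Ut = M.Ut ∩ m ⁻¹' (l '' R.Ut) := by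
    ext w
    constructor
    · rintro ⟨y, hy, rfl⟩
      exact ⟨hmaps hy, y, hy, (hfac y hy).symm⟩
    · rintro ⟨hw, y, hy, h⟩
      exact ⟨y, hy, by rw [Function.comp_apply, h, hm' w hw]⟩
  refine ⟨m' ∘ l,
    { mapsTo := hmaps
      injOn := fun y hy z hz h => hl.injOn hy hz (by rw [← hfac y hy, h, hfac z hz])
      analyticOn := hm'a.comp hl.analyticOn hlm
      isOpen_image := himage ▸
        hm.analyticOn.continuousOn.isOpen_inter_preimage M.isOpen_Ut hl.isOpen_image
      exists_analytic_inv := ⟨l' ∘ m, ?_, fun y hy => ?_⟩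
      comp_p := fun y hy => ?_ }, hfac⟩
  · rw [himage]
    exact hl'a.comp (hm.analyticOn.mono inter_subset_left) fun y hy => hy.2
  · rw [Function.comp_apply, hfac y hy, hl' y hy]
  · rw [← hm.comp_p _ (hmaps hy), hfac y hy, hl.comp_p y hy]

end IsUSEmbedding

/-- Two charts embedded in a third one, with the same image of marked points, are dominated by a
common chart whose two embeddings agree in the third one and preserve the marked points. -/
theorem OrbifoldAtlas.exists_common_refinement (𝒰 : OrbifoldAtlas n X) {a b k : 𝒰.I}
    {l m : CC n → CC n} (hl : IsUSEmbedding (𝒰.chart a) (𝒰.chart k) l)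
    (hm : IsUSEmbedding (𝒰.chart b) (𝒰.chart k) m) {x y : CC n} (hx : x ∈ (𝒰.chart a).Ut)
    (hy : y ∈ (𝒰.chart b).Ut) (hxy : l x = m y) :
    ∃ r, ∃ z ∈ (𝒰.chart r).Ut, ∃ f g, IsUSEmbedding (𝒰.chart r) (𝒰.chart a) f ∧
      IsUSEmbedding (𝒰.chart r) (𝒰.chart b) g ∧
      (∀ w ∈ (𝒰.chart r).Ut, l (f w) = m (g w)) ∧ f z = x ∧ g z = y := by
  have hp : (𝒰.chart b).p y = (𝒰.chart a).p x := by
    rw [← hm.comp_p y hy, ← hxy, hl.comp_p x hx]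
  obtain ⟨r, ⟨z, hz, hzx⟩, hU, ⟨f, hf⟩, -⟩ :=
    𝒰.compat a b ((𝒰.chart a).p x) ⟨⟨x, hx, rfl⟩, ⟨y, hy, hp⟩⟩
  obtain ⟨h, hh, hhx⟩ := (𝒰.chart a).exists_g_of_p_eq (f z) (hf.mapsTo hz) x hx
    ((hf.comp_p z hz).trans hzx)
  have hf' := (IsUSEmbedding.of_mem_G hh).comp hf
  have hlf := hl.comp hf'
  have hlz : (l ∘ h ∘ f) z = m y := by simp [hhx, hxy]
  obtain ⟨g, hg, hmg⟩ := hm.exists_factorization hlf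
    (hm.image_subset_of_mem hlf (hU.trans inter_subset_right) hz ⟨y, hy, hlz.symm⟩)
  exact ⟨r, z, hz, h ∘ f, g, hf', hg, fun w hw => (hmg w hw).symm, hhx,
    hm.injOn (hg.mapsTo hz) hy ((hmg z hz).trans hlz)⟩

end

/-- The relation `∼` on `R̂`: two triples (with the same pairs of target charts) are
related iff there are a chart `(Ũ_m, G_m, π_m)`, a point `x̃_m ∈ Ũ_m` and embeddings
`λ_mk, λ_ml` making the two diagrams (of embeddings and of marked points) commute.
Triples whose targets have different index pairs are declared not related. -/
def RRel {n : ℕ} {X : Type*} [TopologicalSpace X] (𝒰 : OrbifoldAtlas n X)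
    (a b : RHat 𝒰) : Prop :=
  a.i = b.i ∧ a.j = b.j ∧
  ∃ (m : 𝒰.I) (xm : CC n) (_ : xm ∈ (𝒰.chart m).Ut) (mk ml : CC n → CC n),
    IsUSEmbedding (𝒰.chart m) (𝒰.chart a.k) mk ∧
    IsUSEmbedding (𝒰.chart m) (𝒰.chart b.k) ml ∧
    (∀ y ∈ (𝒰.chart m).Ut, a.li (mk y) = b.li (ml y)) ∧
    (∀ y ∈ (𝒰.chart m).Ut, a.lj (mk y) = b.lj (ml y)) ∧
    mk xm = a.x ∧ ml xm = b.x

/-- The relation `∼` on `R̂` is an equivalence relation. -/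
theorem statement12 {n : ℕ} {X : Type*} [TopologicalSpace X] [T2Space X]
    [SecondCountableTopology X] [ParacompactSpace X]
    (𝒰 : OrbifoldAtlas n X) :
    Equivalence (RRel 𝒰) := by
  refine ⟨fun a => ?_, fun {a b} h => ?_, fun {a b c} hab hbc => ?_⟩
  · exact ⟨rfl, rfl, a.k, a.x, a.hx, id, id, .id _, .id _, fun _ _ => rfl, fun _ _ => rfl,
      rfl, rfl⟩
  · obtain ⟨hi, hj, m, xm, hxm, mk, ml, hmk, hml, hci, hcj, hxk, hxl⟩ := h
    exact ⟨hi.symm, hj.symm, m, xm, hxm, ml, mk, hml, hmk, fun y hy => (hci y hy).symm,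
      fun y hy => (hcj y hy).symm, hxl, hxk⟩
  · obtain ⟨hi, hj, m, x, hx, ma, mb, hma, hmb, hci, hcj, hxa, hxb⟩ := hab
    obtain ⟨hi', hj', m', x', hx', mb', mc, hmb', hmc, hci', hcj', hxb', hxc⟩ := hbc
    obtain ⟨r, z, hz, f, g, hf, hg, hfg, rfl, rfl⟩ :=
      𝒰.exists_common_refinement hmb hmb' hx hx' (hxb.trans hxb'.symm)
    refine ⟨hi.trans hi', hj.trans hj', r, z, hz, ma ∘ f, mc ∘ g, hma.comp hf, hmc.comp hg,
      fun y hy => ?_, fun y hy => ?_, hxa, hxc⟩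
    · exact (hci _ (hf.mapsTo hy)).trans
        ((congrArg b.li (hfg y hy)).trans (hci' _ (hg.mapsTo hy)))
    · exact (hcj _ (hf.mapsTo hy)).trans
        ((congrArg b.lj (hfg y hy)).trans (hcj' _ (hg.mapsTo hy)))
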